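/- arXiv:1204.4355 — 2 statements merged into one kernel-verified Lean document; each statement's English description precedes it below -/
import Mathlib

section
/- Let K = F_2(x)[y]/(y^2 + (x^2+x+1)y + x^5+x^4+x^2+x) be the quadratic function field over F_2(x) obtained by adjoining a root y of the irreducible polynomial Y^2 + (x^2+x+1)Y + (x^5+x^4+x^2+x). Then the polynomial T^4 + (x^3+x)T^2 + (x^4+1)T + (x^6+x^3+x^2+x)y + x^16+x^12+x^11+x^10+x^9+x^8+x^7+x^5+x^4+1, in the variable T with coefficients in K, is irreducible over K. (This polynomial defines a degree-4 abelian cover of the genus-2 curve which is a curve of genus 7 with 10 rational points over F_2, the maximum possible.) -/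
open Polynomial

/-- `x` denotes the generator `X` of the rational function field `F₂(x)`. -/
noncomputable def x : RatFunc (ZMod 2) := RatFunc.X

/-- The defining polynomial `Y² + (x²+x+1)Y + (x⁵+x⁴+x²+x)` of the genus-2 base field. -/
noncomputable def p : Polynomial (RatFunc (ZMod 2)) :=
  X ^ 2 + C (x ^ 2 + x + 1) * X + C (x ^ 5 + x ^ 4 + x ^ 2 + x)

/-- The image of `x` in `K = F₂(x)[y]/(p)`. -/
noncomputable def xK : AdjoinRoot p := AdjoinRoot.of p x

/-- The adjoined root `y` in `K = F₂(x)[y]/(p)`. -/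
noncomputable def y : AdjoinRoot p := AdjoinRoot.root p

/-- If `s ^ 2 + s = a + 1` has no solution in a field `K` of characteristic two, and
`c / (a + 1) ^ 6` is congruent to `a + 1` modulo elements of the form `v ^ 2 + v`, then the quartic
`T⁴ + (a³ + a)T² + (a⁴ + 1)T + c` is irreducible over `K`. -/
theorem irreducible_quartic_of_artinSchreier {K : Type*} [Field K] (h2 : (2 : K) = 0) (a c w : K)
    (hs : ∀ s : K, s ^ 2 + s ≠ a + 1)
    (hw : w ^ 2 + w * (a + 1) ^ 3 = c + (a + 1) ^ 7) :
    Irreducible (X ^ 4 + C (a ^ 3 + a) * X ^ 2 + C (a ^ 4 + 1) * X + C c) := by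
  have ha : a + 1 ≠ 0 := fun h => hs 0 (by simp [h])
  have hc : ∀ v : K, v ^ 2 + v * (a + 1) ^ 3 ≠ c := by
    intro v hv
    apply hs ((v + w) / (a + 1) ^ 3)
    field_simp
    linear_combination hv + hw + (v * w + c) * h2
  have hdeg : (X ^ 4 + C (a ^ 3 + a) * X ^ 2 + C (a ^ 4 + 1) * X + C c).natDegree = 4 := by
    compute_degree!
  have hmon : (X ^ 4 + C (a ^ 3 + a) * X ^ 2 + C (a ^ 4 + 1) * X + C c).Monic := by
    monicity!
  rw [hmon.irreducible_iff_natDegree']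
  refine ⟨fun h => by rw [h, natDegree_one] at hdeg; omega, fun f g hf hg hfg hmem => ?_⟩
  have hsum : f.natDegree + g.natDegree = 4 := by rw [← hf.natDegree_mul hg, hfg, hdeg]
  rw [hdeg, Finset.mem_Ioc] at hmem
  obtain hg1 | hg2 : g.natDegree = 1 ∨ g.natDegree = 2 := by omega
  · obtain ⟨r, hr⟩ := exists_root_of_degree_eq_one (degree_eq_iff_natDegree_eq_of_pos one_pos |>.2 hg1)
    have hroot := congrArg (eval r) hfg
    rw [eval_mul, hr.eq_zero, mul_zero] at hroot
    simp only [eval_add, eval_mul, eval_pow, eval_X, eval_C] at hroot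
    apply hc (r ^ 2 + r * (a + 1))
    linear_combination -hroot + (r ^ 3 * (a + 1) + r ^ 2 * (2 * a ^ 2 + 2 * a + 1)
      + r * (2 * a ^ 3 + 3 * a ^ 2 + 2 * a) - c) * h2
  · have hf2 : f.natDegree = 2 := by omega
    have hcoeff (q : K[X]) (hq : q.Monic) (hq2 : q.natDegree = 2) :
        q = X ^ 2 + C (q.coeff 1) * X + C (q.coeff 0) := by
      conv_lhs => rw [hq.as_sum, hq2]
      simp [Finset.sum_range_succ]
      ring
    rw [hcoeff f hf hf2, hcoeff g hg hg2] at hfg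
    generalize f.coeff 1 = m at hfg
    generalize f.coeff 0 = n at hfg
    generalize g.coeff 1 = m' at hfg
    generalize g.coeff 0 = n' at hfg
    have hexp : (X ^ 2 + C m * X + C n) * (X ^ 2 + C m' * X + C n') =
        X ^ 4 + C (m + m') * X ^ 3 + C (n + n' + m * m') * X ^ 2 + C (m * n' + m' * n) * X
          + C (n * n') := by
      simp only [map_add, map_mul]
      ring
    rw [hexp] at hfg
    have e0 := congrArg (coeff · 0) hfg
    have e1 := congrArg (coeff · 1) hfg
    have e2 := congrArg (coeff · 2) hfg
    have e3 := congrArg (coeff · 3) hfg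
    simp only [coeff_add, coeff_C_mul, coeff_X_pow, coeff_X, coeff_C] at e0 e1 e2 e3
    norm_num at e0 e1 e2 e3
    obtain rfl : m' = m := by linear_combination e3 - m * h2
    have hm : (m' + (a + 1)) * (m' ^ 2 + m' * (a + 1) + (a + 1) ^ 3) = 0 := by
      linear_combination m' * e2 - e1 + (m' ^ 2 * (a + 1) + m' * (a ^ 3 + 2 * a ^ 2 + 3 * a + 1)
        + 2 * a ^ 3 + 3 * a ^ 2 + 2 * a) * h2
    rcases mul_eq_zero.1 hm with hm | hm
    · apply hc n
      linear_combination e0 + n * e2 - n * (m' - (a + 1)) * hm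
        + n * (-n' + a ^ 3 + a ^ 2 + a) * h2
    · apply hs (m' / (a + 1))
      field_simp
      linear_combination hm - (a + 1) ^ 3 * h2

theorem artinSchreier_ne_X_add_one (B : (ZMod 2)[X]) : B ^ 2 + B ≠ X + 1 := by
  intro h
  have hX : (X + 1 : (ZMod 2)[X]).natDegree = 1 := natDegree_X_add_C 1
  have hB : (B + 1).natDegree = B.natDegree := natDegree_add_C (a := 1)
  have hprod : B * (B + 1) = X + 1 := by linear_combination h
  have hne : B * (B + 1) ≠ 0 := hprod ▸ X_add_C_ne_zero 1
  have hd := natDegree_mul (left_ne_zero_of_mul hne) (right_ne_zero_of_mul hne)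
  rw [hprod, hX, hB] at hd
  omega

theorem twisted_artinSchreier_ne (B : (ZMod 2)[X]) :
    B ^ 2 + (X ^ 2 + X + 1) * B ≠ (X + 1) * (X ^ 2 + X + 1) := by
  intro h
  have hsep : (X ^ 2 + X + 1 : (ZMod 2)[X]).Separable := by
    refine ⟨0, 1, ?_⟩
    simp [CharTwo.add_self_eq_zero]
  have hdvd : (X ^ 2 + X + 1 : (ZMod 2)[X]) ∣ B ^ 2 :=
    ⟨X + 1 - B, by linear_combination h⟩
  obtain ⟨D, rfl⟩ := hsep.squarefree.isRadical 2 B hdvd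
  have hne : (X ^ 2 + X + 1 : (ZMod 2)[X]) ≠ 0 := by
    intro h0
    have := congrArg (eval 0) h0
    simp at this
  have hdvd' : (X ^ 2 + X + 1 : (ZMod 2)[X]) ∣ X + 1 :=
    ⟨D ^ 2 + D, mul_left_cancel₀ hne (by linear_combination -h)⟩
  have hdeg := natDegree_le_of_dvd hdvd' (X_add_C_ne_zero 1)
  have d1 : (X + 1 : (ZMod 2)[X]).natDegree = 1 := natDegree_X_add_C 1
  have d2 : (X ^ 2 + X + 1 : (ZMod 2)[X]).natDegree = 2 := by compute_degree!
  omega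

theorem exists_algebraMap_eq_of_sq_add_mul {k : Type*} [Field k] (β : RatFunc k)
    (q r : k[X]) (h : β ^ 2 + algebraMap k[X] (RatFunc k) q * β = algebraMap k[X] (RatFunc k) r) :
    ∃ B : k[X], algebraMap k[X] (RatFunc k) B = β ∧ B ^ 2 + q * B = r := by
  have hint : IsIntegral k[X] β := by
    refine ⟨X ^ 2 + C q * X - C r, by monicity!, ?_⟩
    simp [h]
  obtain ⟨B, rfl⟩ := IsIntegrallyClosed.isIntegral_iff.1 hint
  refine ⟨B, rfl, RatFunc.algebraMap_injective k ?_⟩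
  simpa using h

theorem p_monic : p.Monic := by
  unfold p
  monicity!

theorem p_natDegree : p.natDegree = 2 := by
  unfold p
  compute_degree!

theorem exists_eq_add_mul_y (b : AdjoinRoot p) :
    ∃ β γ : RatFunc (ZMod 2), b = AdjoinRoot.of p β + AdjoinRoot.of p γ * y := by
  obtain ⟨q, rfl⟩ := AdjoinRoot.mk_surjective b
  have hp1 : p ≠ 1 := fun h => by simpa [h] using p_natDegree
  have hlt := natDegree_modByMonic_lt q p_monic hp1
  rw [p_natDegree] at hlt
  obtain ⟨γ, β, hq⟩ := exists_eq_X_add_C_of_natDegree_le_one (Nat.le_of_lt_succ hlt)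
  refine ⟨β, γ, ?_⟩
  have hmod : AdjoinRoot.mk p q = AdjoinRoot.mk p (q %ₘ p) := by
    conv_lhs => rw [← modByMonic_add_div q p]
    simp
  rw [hmod, hq, y]
  simp [add_comm]

theorem of_add_of_mul_y_eq_zero {β γ : RatFunc (ZMod 2)}
    (h : AdjoinRoot.of p β + AdjoinRoot.of p γ * y = 0) : β = 0 ∧ γ = 0 := by
  have hmk : AdjoinRoot.mk p (C γ * X + C β) = 0 := by
    rw [← h, y]
    simp [add_comm]
  have hz : C γ * X + C β = 0 := by
    refine eq_zero_of_dvd_of_natDegree_lt (AdjoinRoot.mk_eq_zero.1 hmk) ?_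
    rw [p_natDegree]
    exact Nat.lt_succ_of_le natDegree_linear_le
  exact ⟨by simpa using congrArg (coeff · 0) hz, by simpa using congrArg (coeff · 1) hz⟩

theorem y_sq : y ^ 2 + (xK ^ 2 + xK + 1) * y + (xK ^ 5 + xK ^ 4 + xK ^ 2 + xK) = 0 := by
  have h : AdjoinRoot.mk p
      (X ^ 2 + C (x ^ 2 + x + 1) * X + C (x ^ 5 + x ^ 4 + x ^ 2 + x)) = 0 := AdjoinRoot.mk_self
  simpa [y, xK] using h

theorem two_eq_zero_ratFunc : (2 : RatFunc (ZMod 2)) = 0 := by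
  rw [← map_ofNat (algebraMap (ZMod 2) (RatFunc (ZMod 2))) 2]
  exact (congrArg _ CharTwo.two_eq_zero).trans (map_zero _)

theorem two_eq_zero_adjoinRoot_p : (2 : AdjoinRoot p) = 0 := by
  rw [← map_ofNat (AdjoinRoot.of p) 2]
  exact (congrArg _ two_eq_zero_ratFunc).trans (map_zero _)

theorem artinSchreier_ne_xK_add_one (s : AdjoinRoot p) : s ^ 2 + s ≠ xK + 1 := by
  intro hs
  obtain ⟨β, γ, rfl⟩ := exists_eq_add_mul_y s
  have h2 := two_eq_zero_ratFunc
  have h := @of_add_of_mul_y_eq_zero (β ^ 2 + β - γ ^ 2 * (x ^ 5 + x ^ 4 + x ^ 2 + x) - (x + 1))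
    (γ - γ ^ 2 * (x ^ 2 + x + 1)) (by
      simp only [map_add, map_sub, map_mul, map_pow, map_one]
      change _ - _ * (xK ^ 5 + xK ^ 4 + xK ^ 2 + xK) - (xK + 1) +
        (_ - _ * (xK ^ 2 + xK + 1)) * y = 0
      linear_combination hs - AdjoinRoot.of p γ ^ 2 * y_sq
        - AdjoinRoot.of p β * AdjoinRoot.of p γ * y * two_eq_zero_adjoinRoot_p)
  obtain ⟨h0, h1⟩ := h
  have hx : algebraMap (ZMod 2)[X] (RatFunc (ZMod 2)) X = x := RatFunc.algebraMap_X
  rcases mul_eq_zero.1 (show γ * (1 - γ * (x ^ 2 + x + 1)) = 0 by linear_combination h1)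
    with hγ | hγ
  · obtain ⟨B, -, hB⟩ := exists_algebraMap_eq_of_sq_add_mul β 1 (X + 1) (by
      rw [map_add, map_one, hx]
      linear_combination h0 + γ * (x ^ 5 + x ^ 4 + x ^ 2 + x) * hγ)
    exact artinSchreier_ne_X_add_one B (by linear_combination hB)
  · obtain ⟨B, -, hB⟩ := exists_algebraMap_eq_of_sq_add_mul (β * (x ^ 2 + x + 1))
      (X ^ 2 + X + 1) ((X + 1) * (X ^ 2 + X + 1)) (by
      simp only [map_add, map_mul, map_pow, map_one, hx]
      linear_combination (x ^ 2 + x + 1) ^ 2 * h0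
        - (γ * (x ^ 2 + x + 1) + 1) * (x ^ 5 + x ^ 4 + x ^ 2 + x) * hγ
        + (x ^ 5 + 2 * x ^ 4 + 2 * x ^ 3 + 2 * x ^ 2 + x) * h2)
    exact twisted_artinSchreier_ne B hB

/-- Assuming `p` is irreducible (so that `K = AdjoinRoot p` is the quadratic function
field `F₂(x)(y)`), the polynomial
`T⁴ + (x³+x)T² + (x⁴+1)T + (x⁶+x³+x²+x)y + x¹⁶+x¹²+x¹¹+x¹⁰+x⁹+x⁸+x⁷+x⁵+x⁴+1`
is irreducible over `K`. -/
theorem stmt_1 [Fact (Irreducible p)] :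
    Irreducible (X ^ 4 + C (xK ^ 3 + xK) * X ^ 2 + C (xK ^ 4 + 1) * X +
      C ((xK ^ 6 + xK ^ 3 + xK ^ 2 + xK) * y +
        xK ^ 16 + xK ^ 12 + xK ^ 11 + xK ^ 10 + xK ^ 9 + xK ^ 8 + xK ^ 7 + xK ^ 5 +
          xK ^ 4 + 1)) := by
  have h2 := two_eq_zero_adjoinRoot_p
  refine irreducible_quartic_of_artinSchreier h2 xK _
    (xK ^ 8 + xK ^ 6 + xK ^ 2 + xK + (xK ^ 2 + xK) * y) artinSchreier_ne_xK_add_one ?_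
  linear_combination (xK ^ 2 + xK) ^ 2 * y_sq + (xK ^ 14 + (2 + y) * xK ^ 10
    + (2 + y) * xK ^ 9 + (1 + y) * xK ^ 8 + y * xK ^ 7 - (4 + y) * xK ^ 6 - (12 + y) * xK ^ 5
    + (y - 17) * xK ^ 4 + (3 * y - 14) * xK ^ 3 + (2 * y - 8) * xK ^ 2 - 3 * xK - 1) * h2
end

section
/- Let K = F_2(x)[y]/(y^2 + (x^2+x+1)y + x^5+x^4+x^2+x) be the quadratic function field over F_2(x) obtained by adjoining a root y of the irreducible polynomial Y^2 + (x^2+x+1)Y + (x^5+x^4+x^2+x). Then the polynomial T^8 + (x^5+x^4+x+1)T^6 + (x^7+x^6+x^5+x^4+x^3+x^2+x+1)T^5 + ((x^17+x^15+x^14+x^13+x^12+x^10+x^7+x^5+x+1)y + (x^22+x^20+x^19+x^14+x^12+x^11+x^10+x^7+x^5+x^3+x^2+x))T^4 + (x^11+x^10+x^9+x^8+x^3+x^2+x+1)T^3 + ((x^31+x^29+x^28+x^27+x^24+x^23+x^21+x^16+x^13+x^10+x^9+x^5+x^4+x^3+x^2+x)y + (x^35+x^32+x^31+x^30+x^29+x^27+x^26+x^25+x^24+x^19+x^15+x^12+x^10+x^6+x^5+x^4+x^3+x))T^2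 + ((x^33+x^30+x^28+x^27+x^26+x^25+x^24+x^23+x^21+x^20+x^19+x^18+x^17+x^15+x^14+x^13+x^12+x^11+x^9+x^4+x^3+1)y + (x^37+x^35+x^34+x^33+x^30+x^24+x^23+x^16+x^15+x^13+x^6+x^3+x^2+x))T + (x^54+x^53+x^51+x^50+x^47+x^45+x^44+x^43+x^42+x^41+x^39+x^38+x^37+x^36+x^29+x^24+x^22+x^19+x^17+x^16+x^15+x^11+x^10+x^7+x^6+x^2)y + x^60+x^58+x^57+x^55+x^54+x^53+x^52+x^51+x^47+x^46+x^45+x^40+x^39+x^37+x^35+x^33+x^32+x^30+x^29+x^28+x^26+x^21+x^19+x^18+x^17+x^16+x^15+x^13+x^11+x^9+x^6+x^4+x^2+1, in the variable T with coefficients in K, is irreducible over K. (This polynomial defines the degree-8 abelian cover that is the record curve of genus 17 with 18 rational points over F_2, establishing N_2(17) = 18.) -/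
open Polynomial

set_option maxHeartbeats 2000000

/-- The degree-8 polynomial with `x` and `y` replaced by arbitrary ring elements `a` and `b`. -/
noncomputable def coverPoly {R : Type*} [CommRing R] (a b : R) : R[X] :=
  X ^ 8 +
      C (a ^ 5 + a ^ 4 + a + 1) * X ^ 6 +
      C (a ^ 7 + a ^ 6 + a ^ 5 + a ^ 4 + a ^ 3 + a ^ 2 + a + 1) * X ^ 5 +
      C ((a ^ 17 + a ^ 15 + a ^ 14 + a ^ 13 + a ^ 12 + a ^ 10 + a ^ 7 + a ^ 5 +
            a + 1) * b +
          (a ^ 22 + a ^ 20 + a ^ 19 + a ^ 14 + a ^ 12 + a ^ 11 + a ^ 10 + a ^ 7 +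
            a ^ 5 + a ^ 3 + a ^ 2 + a)) * X ^ 4 +
      C (a ^ 11 + a ^ 10 + a ^ 9 + a ^ 8 + a ^ 3 + a ^ 2 + a + 1) * X ^ 3 +
      C ((a ^ 31 + a ^ 29 + a ^ 28 + a ^ 27 + a ^ 24 + a ^ 23 + a ^ 21 + a ^ 16 +
            a ^ 13 + a ^ 10 + a ^ 9 + a ^ 5 + a ^ 4 + a ^ 3 + a ^ 2 + a) * b +
          (a ^ 35 + a ^ 32 + a ^ 31 + a ^ 30 + a ^ 29 + a ^ 27 + a ^ 26 + a ^ 25 +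
            a ^ 24 + a ^ 19 + a ^ 15 + a ^ 12 + a ^ 10 + a ^ 6 + a ^ 5 + a ^ 4 +
            a ^ 3 + a)) * X ^ 2 +
      C ((a ^ 33 + a ^ 30 + a ^ 28 + a ^ 27 + a ^ 26 + a ^ 25 + a ^ 24 + a ^ 23 +
            a ^ 21 + a ^ 20 + a ^ 19 + a ^ 18 + a ^ 17 + a ^ 15 + a ^ 14 + a ^ 13 +
            a ^ 12 + a ^ 11 + a ^ 9 + a ^ 4 + a ^ 3 + 1) * b +
          (a ^ 37 + a ^ 35 + a ^ 34 + a ^ 33 + a ^ 30 + a ^ 24 + a ^ 23 + a ^ 16 +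
            a ^ 15 + a ^ 13 + a ^ 6 + a ^ 3 + a ^ 2 + a)) * X +
      C ((a ^ 54 + a ^ 53 + a ^ 51 + a ^ 50 + a ^ 47 + a ^ 45 + a ^ 44 + a ^ 43 +
            a ^ 42 + a ^ 41 + a ^ 39 + a ^ 38 + a ^ 37 + a ^ 36 + a ^ 29 + a ^ 24 +
            a ^ 22 + a ^ 19 + a ^ 17 + a ^ 16 + a ^ 15 + a ^ 11 + a ^ 10 + a ^ 7 +
            a ^ 6 + a ^ 2) * b +
          (a ^ 60 + a ^ 58 + a ^ 57 + a ^ 55 + a ^ 54 + a ^ 53 + a ^ 52 + a ^ 51 +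
            a ^ 47 + a ^ 46 + a ^ 45 + a ^ 40 + a ^ 39 + a ^ 37 + a ^ 35 + a ^ 33 +
            a ^ 32 + a ^ 30 + a ^ 29 + a ^ 28 + a ^ 26 + a ^ 21 + a ^ 19 + a ^ 18 +
            a ^ 17 + a ^ 16 + a ^ 15 + a ^ 13 + a ^ 11 + a ^ 9 + a ^ 6 + a ^ 4 +
            a ^ 2 + 1))

lemma coverPoly_monic {R : Type*} [CommRing R] (a b : R) : (coverPoly a b).Monic := by
  unfold coverPoly
  monicity!

lemma map_coverPoly {R S : Type*} [CommRing R] [CommRing S] (f : R →+* S) (a b : R) :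
    (coverPoly a b).map f = coverPoly (f a) (f b) := by
  simp only [coverPoly, Polynomial.map_add, Polynomial.map_mul, Polynomial.map_pow, map_X, map_C,
    Polynomial.map_one, map_add, map_mul, map_pow, map_one]

set_option synthInstance.maxSize 1000 in
lemma irreducible_X_pow_eight_add :
    Irreducible (X ^ 8 + X ^ 6 + X ^ 5 + X ^ 3 + 1 : (ZMod 2)[X]) := by
  have hd : (X ^ 8 + X ^ 6 + X ^ 5 + X ^ 3 + 1 : (ZMod 2)[X]).natDegree = 8 := by
    compute_degree!
  have hm : (X ^ 8 + X ^ 6 + X ^ 5 + X ^ 3 + 1 : (ZMod 2)[X]).Monic := by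
    monicity!
  rw [hm.irreducible_iff_lt_natDegree_lt (fun h => by simp [h] at hd), hd]
  rintro q hq hqd ⟨r, hr⟩
  have hr' : r.Monic := hq.of_mul_monic_left (hr ▸ hm)
  have hs : q.natDegree + r.natDegree = 8 := by rw [← hq.natDegree_mul hr', ← hr, hd]
  have h0 := congrArg (coeff · 0) hr
  have h1 := congrArg (coeff · 1) hr
  have h2 := congrArg (coeff · 2) hr
  have h3 := congrArg (coeff · 3) hr
  have h4 := congrArg (coeff · 4) hr
  have h5 := congrArg (coeff · 5) hr
  have h6 := congrArg (coeff · 6) hr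
  have h7 := congrArg (coeff · 7) hr
  simp only [coeff_add, coeff_X_pow, coeff_one, coeff_mul,
    Finset.Nat.sum_antidiagonal_eq_sum_range_succ (fun i j => q.coeff i * r.coeff j),
    Finset.sum_range_succ, Finset.sum_range_zero] at h0 h1 h2 h3 h4 h5 h6 h7
  norm_num at h0 h1 h2 h3 h4 h5 h6 h7
  have hql := hq.coeff_natDegree
  have hrl := hr'.coeff_natDegree
  have hqz : ∀ n, q.natDegree < n → q.coeff n = 0 := fun n => coeff_eq_zero_of_natDegree_lt
  have hrz : ∀ n, r.natDegree < n → r.coeff n = 0 := fun n => coeff_eq_zero_of_natDegree_lt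
  obtain ⟨hlo, hhi⟩ := Finset.mem_Ioc.mp hqd
  generalize q.natDegree = m at *
  generalize r.natDegree = n at *
  obtain rfl : n = 8 - m := by omega
  clear hr hd hm hq hr' hqd hs
  interval_cases m <;> simp only [hqz, hrz, hql, hrl, Nat.reduceLT, Nat.reduceSub,
    mul_zero, zero_mul, mul_one, one_mul, add_zero, zero_add] at h0 h1 h2 h3 h4 h5 h6 h7
  all_goals
    clear hqz hrz hql hrl hlo hhi
    revert h0 h1 h2 h3 h4 h5 h6 h7
    generalize r.coeff 0 = b₀, r.coeff 1 = b₁, r.coeff 2 = b₂, r.coeff 3 = b₃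
  · generalize q.coeff 0 = a₀, r.coeff 4 = b₄, r.coeff 5 = b₅, r.coeff 6 = b₆
    decide +revert
  · generalize q.coeff 0 = a₀, q.coeff 1 = a₁, r.coeff 4 = b₄, r.coeff 5 = b₅
    decide +revert
  · generalize q.coeff 0 = a₀, q.coeff 1 = a₁, q.coeff 2 = a₂, r.coeff 4 = b₄
    decide +revert
  · generalize q.coeff 0 = a₀, q.coeff 1 = a₁, q.coeff 2 = a₂, q.coeff 3 = a₃
    decide +revert

/-- A special case of Hensel's lemma for power series. -/
lemma PowerSeries.exists_root_of_isUnit {R : Type*} [CommRing R] {u v : PowerSeries R}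
    (hu : IsUnit (constantCoeff u)) (hv : constantCoeff v = 0) :
    ∃ s : PowerSeries R, s ^ 2 + u * s + v = 0 ∧ constantCoeff s = 0 := by
  nontriviality R
  have hf : (Polynomial.X ^ 2 + Polynomial.C u * Polynomial.X + Polynomial.C v).Monic := by
    monicity!
  obtain ⟨s, hs, hs0⟩ := HenselianRing.is_henselian (I := Ideal.span {PowerSeries.X}) _ hf 0
    (by
      rw [Ideal.mem_span_singleton, PowerSeries.X_dvd_iff]
      simpa using hv)
    (by
      apply IsUnit.map
      rw [PowerSeries.isUnit_iff_constantCoeff]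
      simpa [one_add_one_eq_two] using hu)
  refine ⟨s, by simpa using hs, ?_⟩
  rwa [sub_zero, Ideal.mem_span_singleton, PowerSeries.X_dvd_iff] at hs0

open scoped RatFunc in
/-- The embedding of `K` in `F₂((x))` given by the completion at the point `(0, 0)`. -/
lemma exists_ringHom_laurentSeries : ∃ (s : PowerSeries (ZMod 2))
    (φ : AdjoinRoot p →+* LaurentSeries (ZMod 2)), PowerSeries.constantCoeff s = 0 ∧
      φ xK = algebraMap (PowerSeries (ZMod 2)) _ PowerSeries.X ∧ φ y = algebraMap _ _ s := by
  obtain ⟨s, hs, hs0⟩ := PowerSeries.exists_root_of_isUnit (R := ZMod 2)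
    (u := PowerSeries.X ^ 2 + PowerSeries.X + 1)
    (v := PowerSeries.X ^ 5 + PowerSeries.X ^ 4 + PowerSeries.X ^ 2 + PowerSeries.X)
    (by simp) (by simp)
  let ι : PowerSeries (ZMod 2) →+* LaurentSeries (ZMod 2) := algebraMap _ _
  have hX : algebraMap (RatFunc (ZMod 2)) (LaurentSeries (ZMod 2)) x = ι PowerSeries.X := by
    rw [x, RatFunc.coe_X]
    exact PowerSeries.coe_X.symm
  have hroot : p.eval₂ (algebraMap (RatFunc (ZMod 2)) (LaurentSeries (ZMod 2))) (ι s) = 0 := by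
    simp only [p, eval₂_add, eval₂_mul, eval₂_pow, eval₂_X, eval₂_C, map_add, map_pow, map_one, hX,
      eval₂_one]
    rw [← map_zero ι, ← hs]
    simp only [map_add, map_mul, map_pow, map_one]
  exact ⟨s, AdjoinRoot.lift _ _ hroot, hs0, by rw [xK, AdjoinRoot.lift_of, hX],
    by rw [y, AdjoinRoot.lift_root]⟩

/-- Assuming `p` is irreducible (so that `K = AdjoinRoot p` is the quadratic function field
`F₂(x)(y)`), the degree-8 polynomial below (defining the record curve of genus 17 with 18
rational points over `F₂`) is irreducible over `K`. -/
theorem stmt_2 [Fact (Irreducible p)] :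
    Irreducible (X ^ 8 +
      C (xK ^ 5 + xK ^ 4 + xK + 1) * X ^ 6 +
      C (xK ^ 7 + xK ^ 6 + xK ^ 5 + xK ^ 4 + xK ^ 3 + xK ^ 2 + xK + 1) * X ^ 5 +
      C ((xK ^ 17 + xK ^ 15 + xK ^ 14 + xK ^ 13 + xK ^ 12 + xK ^ 10 + xK ^ 7 + xK ^ 5 +
            xK + 1) * y +
          (xK ^ 22 + xK ^ 20 + xK ^ 19 + xK ^ 14 + xK ^ 12 + xK ^ 11 + xK ^ 10 + xK ^ 7 +
            xK ^ 5 + xK ^ 3 + xK ^ 2 + xK)) * X ^ 4 +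
      C (xK ^ 11 + xK ^ 10 + xK ^ 9 + xK ^ 8 + xK ^ 3 + xK ^ 2 + xK + 1) * X ^ 3 +
      C ((xK ^ 31 + xK ^ 29 + xK ^ 28 + xK ^ 27 + xK ^ 24 + xK ^ 23 + xK ^ 21 + xK ^ 16 +
            xK ^ 13 + xK ^ 10 + xK ^ 9 + xK ^ 5 + xK ^ 4 + xK ^ 3 + xK ^ 2 + xK) * y +
          (xK ^ 35 + xK ^ 32 + xK ^ 31 + xK ^ 30 + xK ^ 29 + xK ^ 27 + xK ^ 26 + xK ^ 25 +
            xK ^ 24 + xK ^ 19 + xK ^ 15 + xK ^ 12 + xK ^ 10 + xK ^ 6 + xK ^ 5 + xK ^ 4 +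
            xK ^ 3 + xK)) * X ^ 2 +
      C ((xK ^ 33 + xK ^ 30 + xK ^ 28 + xK ^ 27 + xK ^ 26 + xK ^ 25 + xK ^ 24 + xK ^ 23 +
            xK ^ 21 + xK ^ 20 + xK ^ 19 + xK ^ 18 + xK ^ 17 + xK ^ 15 + xK ^ 14 + xK ^ 13 +
            xK ^ 12 + xK ^ 11 + xK ^ 9 + xK ^ 4 + xK ^ 3 + 1) * y +
          (xK ^ 37 + xK ^ 35 + xK ^ 34 + xK ^ 33 + xK ^ 30 + xK ^ 24 + xK ^ 23 + xK ^ 16 +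
            xK ^ 15 + xK ^ 13 + xK ^ 6 + xK ^ 3 + xK ^ 2 + xK)) * X +
      C ((xK ^ 54 + xK ^ 53 + xK ^ 51 + xK ^ 50 + xK ^ 47 + xK ^ 45 + xK ^ 44 + xK ^ 43 +
            xK ^ 42 + xK ^ 41 + xK ^ 39 + xK ^ 38 + xK ^ 37 + xK ^ 36 + xK ^ 29 + xK ^ 24 +
            xK ^ 22 + xK ^ 19 + xK ^ 17 + xK ^ 16 + xK ^ 15 + xK ^ 11 + xK ^ 10 + xK ^ 7 +
            xK ^ 6 + xK ^ 2) * y +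
          (xK ^ 60 + xK ^ 58 + xK ^ 57 + xK ^ 55 + xK ^ 54 + xK ^ 53 + xK ^ 52 + xK ^ 51 +
            xK ^ 47 + xK ^ 46 + xK ^ 45 + xK ^ 40 + xK ^ 39 + xK ^ 37 + xK ^ 35 + xK ^ 33 +
            xK ^ 32 + xK ^ 30 + xK ^ 29 + xK ^ 28 + xK ^ 26 + xK ^ 21 + xK ^ 19 + xK ^ 18 +
            xK ^ 17 + xK ^ 16 + xK ^ 15 + xK ^ 13 + xK ^ 11 + xK ^ 9 + xK ^ 6 + xK ^ 4 +
            xK ^ 2 + 1))) := by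
  change Irreducible (coverPoly xK y)
  obtain ⟨s, φ, hs0, hφx, hφy⟩ := exists_ringHom_laurentSeries
  refine (coverPoly_monic _ _).irreducible_of_irreducible_map φ _ ?_
  rw [map_coverPoly, hφx, hφy, ← map_coverPoly,
    ← (coverPoly_monic _ _).irreducible_iff_irreducible_map_fraction_map]
  refine (coverPoly_monic _ _).irreducible_of_irreducible_map PowerSeries.constantCoeff _ ?_
  rw [map_coverPoly, PowerSeries.constantCoeff_X, hs0]
  simpa [coverPoly] using irreducible_X_pow_eight_add
end
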